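/- Let (x₀, x₁) be uniformly distributed on {0,1}², and let Z be a box with binary input t and output x_t (joint state P(x₀, x₁, z_out | z_in) = 1/4 if z_out = x_{z_in}, else 0). Define the entropies as minima of outcome Shannon entropy over fine-grained adaptive strategies: Ĥ(X₀X₁Z) = min over f : {0,1}² → {0,1} of H(x₀, x₁, x_{f(x₀,x₁)}); Ĥ(X₀Z) = min over f : {0,1} → {0,1} of H(x₀, x_{f(x₀)}); Ĥ(X₁Z) = min over f : {0,1} → {0,1} of H(x₁, x_{f(x₁)}); Ĥ(Z) = min over t ∈ {0,1} of H(x_t); Ĥ(X₀) = H(x₀), Ĥ(X₁) = H(x₁), Ĥ(X₀X₁) = H(x₀,x₁). Then Ĥ(X₀) = Ĥ(X₁) = Ĥ(Z) = 1, Ĥ(X₀X₁) = 2, Ĥ(X₀X₁Z) = 2, and Ĥ(X₀Z) = Ĥ(X₁Z) = 1. Consequently Ĥ(X₀X₁Z) + Ĥ(Z) = 3 > 2 = Ĥ(X₀Z) + Ĥ(X₁Z), so strong subadditivity of Ĥ is violated in box world. -/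

import Mathlib

open scoped BigOperators

/-- Shannon entropy (base 2) of a probability vector, with the convention `0 * log 0 = 0`. -/
noncomputable def shannonH {α : Type*} [Fintype α] (q : α → ℝ) : ℝ :=
  -∑ a, q a * Real.logb 2 (q a)

/-- `sel t x₀ x₁ = x_t`. -/
def sel (t x₀ x₁ : Bool) : Bool := bif t then x₁ else x₀

/-- Outcome distribution of the strategy `f : {0,1}² → {0,1}` on `X₀X₁Z`:
the distribution of `(x₀, x₁, x_{f(x₀,x₁)})` with `(x₀,x₁)` uniform. -/
noncomputable def distX0X1Z (f : Bool → Bool → Bool) : Bool × Bool × Bool → ℝ :=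
  fun o => if o.2.2 = sel (f o.1 o.2.1) o.1 o.2.1 then 1 / 4 else 0

/-- Distribution of `(x₀, x_{f(x₀)})`. -/
noncomputable def distX0Z (f : Bool → Bool) : Bool × Bool → ℝ :=
  fun o => ∑ x₁ : Bool, if o.2 = sel (f o.1) o.1 x₁ then 1 / 4 else 0

/-- Distribution of `(x₁, x_{f(x₁)})`. -/
noncomputable def distX1Z (f : Bool → Bool) : Bool × Bool → ℝ :=
  fun o => ∑ x₀ : Bool, if o.2 = sel (f o.1) x₀ o.1 then 1 / 4 else 0

/-- Distribution of `x_t`. -/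
noncomputable def distZ (t : Bool) : Bool → ℝ :=
  fun z => ∑ x₀ : Bool, ∑ x₁ : Bool, if z = sel t x₀ x₁ then 1 / 4 else 0

lemma logb_two_half : Real.logb 2 (1 / 2) = -1 := by
  simp [Real.logb_inv]

lemma logb_two_quarter : Real.logb 2 (1 / 4) = -2 := by
  rw [show (1 / 4 : ℝ) = 2 ^ (-2 : ℝ) by norm_num [Real.rpow_neg], Real.logb_rpow] <;> norm_num

lemma shannonH_uniform_bool : shannonH (fun _ : Bool => (1 / 2 : ℝ)) = 1 := by
  simp only [shannonH, logb_two_half, Fintype.sum_bool]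
  norm_num

lemma shannonH_uniform_bool_prod :
    shannonH (fun _ : Bool × Bool => (1 / 4 : ℝ)) = 2 := by
  simp only [shannonH, logb_two_quarter, Fintype.sum_prod_type, Fintype.sum_bool]
  norm_num

lemma distZ_eq_uniform (t : Bool) : distZ t = fun _ => 1 / 2 := by
  funext z
  cases t <;> cases z <;> norm_num [distZ, sel]

lemma shannonH_distX0X1Z (f : Bool → Bool → Bool) : shannonH (distX0X1Z f) = 2 := by
  have fiber (b : Bool) :
      ∑ z, (if z = b then (1 / 4 : ℝ) else 0) * Real.logb 2 (if z = b then 1 / 4 else 0)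
        = -1 / 2 := by
    simp only [ite_mul, zero_mul, Finset.sum_ite_eq', Finset.mem_univ, if_true, logb_two_quarter]
    norm_num
  simp only [shannonH, distX0X1Z, Fintype.sum_prod_type, fiber, Fintype.sum_bool]
  norm_num

/-- Reading the bit that is already known contributes no entropy beyond that of the bit itself. -/
lemma shannonH_distX0Z (f : Bool → Bool) :
    shannonH (distX0Z f) = ∑ x₀, if f x₀ = false then (1 / 2 : ℝ) else 1 := by
  have fiber (x₀ : Bool) : ∑ z, distX0Z f (x₀, z) * Real.logb 2 (distX0Z f (x₀, z))
      = -if f x₀ = false then (1 / 2 : ℝ) else 1 := by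
    cases hf : f x₀ <;> cases x₀ <;>
      norm_num [distX0Z, sel, hf, -one_div, logb_two_half, logb_two_quarter]
  simp only [shannonH, Fintype.sum_prod_type, fiber, Finset.sum_neg_distrib, neg_neg]

lemma distX1Z_eq_distX0Z (f : Bool → Bool) : distX1Z f = distX0Z (fun x => !f x) := by
  funext ⟨x, z⟩
  cases h : f x <;> simp [distX1Z, distX0Z, sel, h]

lemma one_le_shannonH_distX0Z (f : Bool → Bool) : 1 ≤ shannonH (distX0Z f) := by
  rw [shannonH_distX0Z, Fintype.sum_bool]
  split_ifs <;> norm_num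

lemma shannonH_distX0Z_false : shannonH (distX0Z fun _ => false) = 1 := by
  norm_num [shannonH_distX0Z]

/-- the entropies of the perfect random access encoding state,
defined as minima of outcome Shannon entropy over fine-grained adaptive strategies,
are `Ĥ(X₀) = Ĥ(X₁) = Ĥ(Z) = 1`, `Ĥ(X₀X₁) = 2`, `Ĥ(X₀X₁Z) = 2`, `Ĥ(X₀Z) = Ĥ(X₁Z) = 1`;
consequently `Ĥ(X₀X₁Z) + Ĥ(Z) > Ĥ(X₀Z) + Ĥ(X₁Z)`, violating strong subadditivity. -/
theorem boxWorld_strong_subadditivity_violation :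
    shannonH (fun _ : Bool => (1 / 2 : ℝ)) = 1 ∧
    shannonH (fun _ : Bool × Bool => (1 / 4 : ℝ)) = 2 ∧
    IsLeast { h : ℝ | ∃ t : Bool, h = shannonH (distZ t) } 1 ∧
    IsLeast { h : ℝ | ∃ f : Bool → Bool → Bool, h = shannonH (distX0X1Z f) } 2 ∧
    IsLeast { h : ℝ | ∃ f : Bool → Bool, h = shannonH (distX0Z f) } 1 ∧
    IsLeast { h : ℝ | ∃ f : Bool → Bool, h = shannonH (distX1Z f) } 1 ∧
    sInf { h : ℝ | ∃ f : Bool → Bool → Bool, h = shannonH (distX0X1Z f) }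
        + sInf { h : ℝ | ∃ t : Bool, h = shannonH (distZ t) }
      > sInf { h : ℝ | ∃ f : Bool → Bool, h = shannonH (distX0Z f) }
        + sInf { h : ℝ | ∃ f : Bool → Bool, h = shannonH (distX1Z f) } := by
  have hZ : IsLeast { h : ℝ | ∃ t : Bool, h = shannonH (distZ t) } 1 := by
    simp [distZ_eq_uniform, shannonH_uniform_bool, -one_div]
  have hX0X1Z : IsLeast { h : ℝ | ∃ f : Bool → Bool → Bool, h = shannonH (distX0X1Z f) } 2 := by
    simp [shannonH_distX0X1Z]
  have hX0Z : IsLeast { h : ℝ | ∃ f : Bool → Bool, h = shannonH (distX0Z f) } 1 := by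
    refine ⟨⟨fun _ => false, shannonH_distX0Z_false.symm⟩, ?_⟩
    rintro _ ⟨f, rfl⟩
    exact one_le_shannonH_distX0Z f
  have hX1Z : IsLeast { h : ℝ | ∃ f : Bool → Bool, h = shannonH (distX1Z f) } 1 := by
    refine ⟨⟨fun _ => true, ?_⟩, ?_⟩
    · rw [distX1Z_eq_distX0Z]
      exact shannonH_distX0Z_false.symm
    · rintro _ ⟨f, rfl⟩
      rw [distX1Z_eq_distX0Z]
      exact one_le_shannonH_distX0Z _
  refine ⟨shannonH_uniform_bool, shannonH_uniform_bool_prod, hZ, hX0X1Z, hX0Z, hX1Z, ?_⟩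
  rw [hX0X1Z.csInf_eq, hZ.csInf_eq, hX0Z.csInf_eq, hX1Z.csInf_eq]
  norm_num
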